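/- Let K be an integral domain and L a Lie algebra over K that is free as a K-module. Then every unit of the universal enveloping algebra U(L) belongs to (the image of) K: if u ∈ U(L) is invertible, then u = ι(c) for some c ∈ K (necessarily a unit of K). -/

import Mathlib

open MvPolynomial

namespace PBW

variable {K L I : Type} [CommRing K] [LieRing L] [LieAlgebra K L] [LinearOrder I]

/-- The monomial with exponent `M`. -/
noncomputable def mon (K : Type) {I : Type} [CommRing K] (M : I →₀ ℕ) : MvPolynomial I K :=
  monomial M 1

/-- Polynomials of degree `< n`. -/
noncomputable def D (K I : Type) [CommRing K] (n : ℕ) : Submodule K (MvPolynomial I K) :=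
  Submodule.span K {p | ∃ M : I →₀ ℕ, M.degree < n ∧ p = mon K M}

/-- `j` is at most every index in `N`. -/
def Le (j : I) (N : I →₀ ℕ) : Prop := ∀ k, N k ≠ 0 → j ≤ k

omit [LinearOrder I] in
lemma X_mon (i : I) (M : I →₀ ℕ) :
    (X i : MvPolynomial I K) * mon K M = mon K (Finsupp.single i 1 + M) := by
  simp [mon, X, monomial_mul]

lemma Le_unique {j j' : I} {N N' : I →₀ ℕ} (h : Le j N) (h' : Le j' N')
    (e : Finsupp.single j 1 + N = Finsupp.single j' 1 + N') : j = j' ∧ N = N' := by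
  have hj : j = j' := by
    apply le_antisymm
    · have := DFunLike.congr_fun e j'
      simp [Finsupp.single_apply] at this
      by_cases hjj : j = j'
      · exact hjj.le
      · simp [hjj] at this
        exact h _ (by omega)
    · have := DFunLike.congr_fun e j
      simp [Finsupp.single_apply] at this
      by_cases hjj : j' = j
      · exact hjj.le
      · simp [hjj] at this
        exact h' _ (by omega)
  subst hj
  exact ⟨rfl, add_left_cancel e⟩

lemma Le_exists {M : I →₀ ℕ} (hM : M ≠ 0) : ∃ j N, M = Finsupp.single j 1 + N ∧ Le j N := by
  have hs : M.support.Nonempty := Finsupp.support_nonempty_iff.2 hM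
  have hmem := Finset.min'_mem M.support hs
  have hle : ∀ k, M k ≠ 0 → M.support.min' hs ≤ k := fun k hk =>
    Finset.min'_le _ _ (Finsupp.mem_support_iff.2 hk)
  generalize M.support.min' hs = j at hmem hle
  rw [Finsupp.mem_support_iff] at hmem
  have e : M = Finsupp.single j 1 + (M - Finsupp.single j 1) := by
    rw [add_tsub_cancel_of_le]
    rw [Finsupp.single_le_iff]; omega
  refine ⟨j, M - Finsupp.single j 1, e, fun k hk => hle k ?_⟩
  simp at hk
  omega

section
omit [LinearOrder I]

lemma D_mono {m n : ℕ} (h : m ≤ n) : D K I m ≤ D K I n :=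
  Submodule.span_mono (fun _ ⟨M, hM, e⟩ => ⟨M, by omega, e⟩)

lemma mon_mem {M : I →₀ ℕ} {n : ℕ} (h : M.degree < n) : mon K M ∈ D K I n :=
  Submodule.subset_span ⟨M, h, rfl⟩

lemma deg_single (i : I) (M : I →₀ ℕ) : (Finsupp.single i 1 + M).degree = M.degree + 1 := by
  simp [add_comm]

lemma X_mem {i : I} {p : MvPolynomial I K} {n : ℕ} (h : p ∈ D K I n) :
    X i * p ∈ D K I (n + 1) := by
  induction h using Submodule.span_induction with
  | mem x h =>
    obtain ⟨M, hM, rfl⟩ := h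
    rw [X_mon]
    exact mon_mem (by rw [deg_single]; omega)
  | zero => simp
  | add x y _ _ hx hy => rw [mul_add]; exact add_mem hx hy
  | smul a x _ hx => rw [mul_smul_comm]; exact Submodule.smul_mem _ _ hx

/-- A linear map sending the monomials of degree `< n` into `Q` sends `D n` into `Q`. -/
lemma D_le {n : ℕ} (f : MvPolynomial I K →ₗ[K] MvPolynomial I K)
    (Q : Submodule K (MvPolynomial I K))
    (h : ∀ M : I →₀ ℕ, M.degree < n → f (mon K M) ∈ Q) {p} (hp : p ∈ D K I n) : f p ∈ Q := by
  have : D K I n ≤ Q.comap f := Submodule.span_le.2 (by rintro _ ⟨M, hM, rfl⟩; exact h M hM)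
  exact this hp

lemma D_eq {n : ℕ} (f g : MvPolynomial I K →ₗ[K] MvPolynomial I K)
    (h : ∀ M : I →₀ ℕ, M.degree < n → f (mon K M) = g (mon K M)) {p} (hp : p ∈ D K I n) :
    f p = g p := by
  have := D_le (f - g) ⊥ (fun M hM => by simp [h M hM]) hp
  simpa [sub_eq_zero] using this

lemma mem_D (p : MvPolynomial I K) : ∃ n, p ∈ D K I n := by
  induction p using MvPolynomial.induction_on' with
  | monomial M a =>
    refine ⟨M.degree + 1, ?_⟩
    have : monomial M a = a • mon K M := by rw [mon, smul_monomial, smul_eq_mul, mul_one]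
    rw [this]
    exact Submodule.smul_mem _ _ (mon_mem (by omega))
  | add p q hp hq =>
    obtain ⟨n, hn⟩ := hp
    obtain ⟨m, hm⟩ := hq
    exact ⟨max n m, add_mem (D_mono (le_max_left _ _) hn) (D_mono (le_max_right _ _) hm)⟩
end

omit [LinearOrder I] in
lemma basis_ind (b : Module.Basis I K L) {P : L → Prop} (zero : P 0) (coe : ∀ i, P (b i))
    (add : ∀ x y, P x → P y → P (x + y)) (smul : ∀ (a : K) x, P x → P (a • x)) (x : L) : P x := by
  have hx : x ∈ Submodule.span K (Set.range b) := by rw [b.span_eq]; trivial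
  induction hx using Submodule.span_induction with
  | mem x h => obtain ⟨i, rfl⟩ := h; exact coe i
  | zero => exact zero
  | add x y _ _ hx hy => exact add x y hx hy
  | smul a x _ hx => exact smul a x hx

abbrev Act (K L I : Type) [CommRing K] [LieRing L] [LieAlgebra K L] :=
  L →ₗ[K] MvPolynomial I K →ₗ[K] MvPolynomial I K

/-- Build an action from values on basis elements and monomials. -/
noncomputable def mkAct (b : Module.Basis I K L) (f : I → (I →₀ ℕ) → MvPolynomial I K) :
    Act K L I :=
  b.constr K (fun i => (basisMonomials I K).constr K (f i))

omit [LinearOrder I] in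
lemma mkAct_apply (b : Module.Basis I K L) (f : I → (I →₀ ℕ) → MvPolynomial I K) (i M) :
    mkAct b f (b i) (mon K M) = f i M := by
  have : mon K M = basisMonomials I K M := by simp [mon]
  rw [mkAct, Module.Basis.constr_basis, this, Module.Basis.constr_basis]

open Classical in
noncomputable def corr (b : Module.Basis I K L) (G : Act K L I) (i : I) (M : I →₀ ℕ) :
    MvPolynomial I K :=
  if h : ∃ jN : I × (I →₀ ℕ), M = Finsupp.single jN.1 1 + jN.2 ∧ Le jN.1 jN.2 ∧ jN.1 < i then
    G (b h.choose.1) (G (b i) (mon K h.choose.2) - X i * mon K h.choose.2)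
      + G ⁅b i, b h.choose.1⁆ (mon K h.choose.2)
  else 0

lemma corr_pos (b : Module.Basis I K L) (G : Act K L I) {i j : I} {N : I →₀ ℕ} (h : Le j N)
    (hj : j < i) : corr b G i (Finsupp.single j 1 + N) =
      G (b j) (G (b i) (mon K N) - X i * mon K N) + G ⁅b i, b j⁆ (mon K N) := by
  have H : ∃ jN : I × (I →₀ ℕ), Finsupp.single j 1 + N = Finsupp.single jN.1 1 + jN.2 ∧
      Le jN.1 jN.2 ∧ jN.1 < i := ⟨(j, N), rfl, h, hj⟩
  rw [corr, dif_pos H]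
  have hs := H.choose_spec
  obtain ⟨e1, e2⟩ := Le_unique h hs.2.1 hs.1
  rw [← e1, ← e2]

lemma corr_cases (i : I) (M : I →₀ ℕ) :
    (∃ j N, M = Finsupp.single j 1 + N ∧ Le j N ∧ j < i) ∨
    ∀ (b : Module.Basis I K L) (G : Act K L I), corr b G i M = 0 := by
  by_cases H : ∃ jN : I × (I →₀ ℕ), M = Finsupp.single jN.1 1 + jN.2 ∧ Le jN.1 jN.2 ∧ jN.1 < i
  · obtain ⟨⟨j, N⟩, h⟩ := H
    exact Or.inl ⟨j, N, h⟩
  · right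
    intro b G
    rw [corr, dif_neg H]

lemma corr_neg (b : Module.Basis I K L) (G : Act K L I) {i : I} {M : I →₀ ℕ} (h : Le i M) :
    corr b G i M = 0 := by
  rcases corr_cases (K := K) (L := L) i M with ⟨j, N, rfl, _, h2⟩ | h'
  · exact absurd (h j (by simp)) (not_le.2 h2)
  · exact h' b G

noncomputable def F (b : Module.Basis I K L) : ℕ → Act K L I
  | 0 => mkAct b (fun i M => X i * mon K M)
  | n + 1 => mkAct b (fun i M => X i * mon K M + corr b (F b n) i M)

omit [LinearOrder I] in
lemma act_mem (b : Module.Basis I K L) (G : Act K L I)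
    (h : ∀ i m p, p ∈ D K I m → G (b i) p - X i * p ∈ D K I m) (x : L) {m p} (hp : p ∈ D K I m) :
    G x p ∈ D K I (m + 1) := by
  induction x using basis_ind b with
  | zero => simp
  | coe i =>
    have := add_mem (D_mono (Nat.le_succ m) (h i m p hp)) (X_mem (i := i) hp)
    simpa using this
  | add x y hx hy => simpa using add_mem hx hy
  | smul a x hx => simpa using Submodule.smul_mem _ a hx

lemma F_sub (b : Module.Basis I K L) (n : ℕ) :
    ∀ i m p, p ∈ D K I m → F b n (b i) p - X i * p ∈ D K I m := by
  induction n with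
  | zero =>
    intro i m p hp
    refine D_le (F b 0 (b i) - LinearMap.mulLeft K (X i)) _ (fun M hM => ?_) hp
    simp [F, mkAct_apply]
  | succ n ih =>
    intro i m p hp
    refine D_le (F b (n+1) (b i) - LinearMap.mulLeft K (X i)) _ (fun M hM => ?_) hp
    simp only [F, LinearMap.sub_apply, mkAct_apply, LinearMap.mulLeft_apply, add_sub_cancel_left]
    rcases corr_cases (K := K) (L := L) i M with ⟨j, N, rfl, h1, h2⟩ | h'
    · rw [corr_pos b _ h1 h2]
      rw [deg_single] at hM
      have hN : mon K N ∈ D K I (N.degree + 1) := mon_mem (by omega)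
      exact D_mono (by omega : N.degree + 1 + 1 ≤ m)
        (add_mem (act_mem b _ ih _ (ih _ _ _ hN)) (act_mem b _ ih _ hN))
    · rw [h']; exact zero_mem _

omit [LinearOrder I] in
lemma act_eq (b : Module.Basis I K L) (G H : Act K L I) {n : ℕ}
    (h : ∀ i (M : I →₀ ℕ), M.degree < n → G (b i) (mon K M) = H (b i) (mon K M)) (x : L) {p}
    (hp : p ∈ D K I n) : G x p = H x p := by
  induction x using basis_ind b with
  | zero => simp
  | coe i => exact D_eq _ _ (h i) hp
  | add x y hx hy => simp [hx, hy]
  | smul a x hx => simp [hx]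

lemma F_succ (b : Module.Basis I K L) (n : ℕ) :
    ∀ x p, p ∈ D K I (n + 1) → F b (n + 1) x p = F b n x p := by
  induction n with
  | zero =>
    intro x p hp
    refine act_eq b _ _ (fun i M hM => ?_) x hp
    have : M = 0 := by rw [← Finsupp.degree_eq_zero_iff]; omega
    subst this
    simp only [F, mkAct_apply]
    rw [corr_neg _ _ (fun k hk => absurd rfl hk), add_zero]
  | succ n ih =>
    intro x p hp
    refine act_eq b _ _ (fun i M hM => ?_) x hp
    rw [F, mkAct_apply]
    conv_rhs => rw [F, mkAct_apply]
    congr 1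
    rcases corr_cases (K := K) (L := L) i M with ⟨j, N, rfl, h1, h2⟩ | h'
    · rw [deg_single] at hM
      have hN : mon K N ∈ D K I (n + 1) := mon_mem (by omega)
      rw [corr_pos b _ h1 h2, corr_pos b _ h1 h2, ih _ _ hN, ih _ _ hN,
        ih _ _ (F_sub b n i _ _ hN)]
    · rw [h', h']

lemma F_stable (b : Module.Basis I K L) {m n : ℕ} (h : m ≤ n) (x p) (hp : p ∈ D K I (m + 1)) :
    F b n x p = F b m x p := by
  induction n, h using Nat.le_induction with
  | base => rfl
  | succ n hn ih => rw [F_succ b n x p (D_mono (by omega) hp), ih]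

/-- The PBW action. -/
noncomputable def Phi (b : Module.Basis I K L) : Act K L I :=
  mkAct b (fun i M => F b M.degree (b i) (mon K M))

lemma Phi_eq (b : Module.Basis I K L) (n : ℕ) (x p) (hp : p ∈ D K I (n + 1)) :
    Phi b x p = F b n x p := by
  refine act_eq b _ _ (fun i M hM => ?_) x hp
  rw [Phi, mkAct_apply, F_stable b (by omega : M.degree ≤ n) _ _ (mon_mem (by omega))]

lemma Phi_sub (b : Module.Basis I K L) (i m p) (hp : p ∈ D K I m) :
    Phi b (b i) p - X i * p ∈ D K I m := by
  rw [Phi_eq b m _ _ (D_mono (by omega) hp)]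
  exact F_sub b m i m p hp

lemma Phi_mem (b : Module.Basis I K L) (x : L) {m p} (hp : p ∈ D K I m) :
    Phi b x p ∈ D K I (m + 1) := act_mem b _ (Phi_sub b) x hp

lemma Phi_le (b : Module.Basis I K L) {i : I} {M : I →₀ ℕ} (h : Le i M) :
    Phi b (b i) (mon K M) = mon K (Finsupp.single i 1 + M) := by
  rw [Phi_eq b (M.degree + 1) _ _ (mon_mem (by omega)), F, mkAct_apply, corr_neg _ _ h, add_zero,
    X_mon]

lemma Phi_lt (b : Module.Basis I K L) {i j : I} {N : I →₀ ℕ} (h : Le j N) (hj : j < i) :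
    Phi b (b i) (mon K (Finsupp.single j 1 + N)) =
      X i * mon K (Finsupp.single j 1 + N) +
      (Phi b (b j) (Phi b (b i) (mon K N) - X i * mon K N) + Phi b ⁅b i, b j⁆ (mon K N)) := by
  have hN : mon K N ∈ D K I (N.degree + 1) := mon_mem (by omega)
  rw [Phi_eq b (N.degree + 1) _ _ (mon_mem (by rw [deg_single]; omega)), F, mkAct_apply,
    corr_pos _ _ h hj, Phi_eq b N.degree _ _ (Phi_sub b i _ _ hN),
    Phi_eq b N.degree _ _ hN, Phi_eq b N.degree _ _ hN]

/-- The commutation relation at `p`. -/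
def C (b : Module.Basis I K L) (x y : L) (p : MvPolynomial I K) : Prop :=
  Phi b x (Phi b y p) - Phi b y (Phi b x p) = Phi b ⁅x, y⁆ p

lemma C_symm (b : Module.Basis I K L) {x y p} (h : C b x y p) : C b y x p := by
  unfold C at *
  rw [← lie_skew, map_neg, LinearMap.neg_apply, ← h, neg_sub]

lemma C_lt (b : Module.Basis I K L) {i j : I} {N : I →₀ ℕ} (h : Le j N) (hj : j < i) :
    C b (b i) (b j) (mon K N) := by
  unfold C
  have h2 : Le j (Finsupp.single i 1 + N) := by
    intro k hk
    by_cases e : i = k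
    · exact e ▸ hj.le
    · exact h k (by simpa [Finsupp.single_apply, e] using hk)
  rw [Phi_le b h, Phi_lt b h hj, map_sub, X_mon i N, Phi_le b h2, X_mon,
    add_left_comm (Finsupp.single i 1) (Finsupp.single j 1) N]
  abel

lemma C_le (b : Module.Basis I K L) {i j : I} {N : I →₀ ℕ} (h : Le j N) :
    C b (b i) (b j) (mon K N) := by
  rcases lt_trichotomy i j with hi | rfl | hi
  · exact C_symm b (C_lt b (fun k hk => hi.le.trans (h k hk)) hi)
  · simp [C]
  · exact C_lt b h hi

lemma C_add (b : Module.Basis I K L) {x y p q} (h : C b x y p) (h' : C b x y q) :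
    C b x y (p + q) := by
  unfold C at *
  simp only [map_add]
  rw [← h, ← h']
  abel

lemma C_bilin (b : Module.Basis I K L) {p} (h : ∀ i j, C b (b i) (b j) p) (x y : L) :
    C b x y p := by
  unfold C at *
  induction x using basis_ind b with
  | zero => simp
  | coe i =>
    induction y using basis_ind b with
    | zero => simp
    | coe j => exact h i j
    | add x y hx hy =>
      simp only [map_add, LinearMap.add_apply, lie_add]; rw [← hx, ← hy]; abel
    | smul a x hx =>
      simp only [map_smul, LinearMap.smul_apply, lie_smul]; rw [← hx, smul_sub]
  | add x y hx hy =>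
      simp only [map_add, LinearMap.add_apply, add_lie]; rw [← hx, ← hy]; abel
  | smul a x hx =>
      simp only [map_smul, LinearMap.smul_apply, smul_lie]; rw [← hx, smul_sub]

lemma C_all (b : Module.Basis I K L) (n : ℕ) : ∀ x y p, p ∈ D K I n → C b x y p := by
  induction n with
  | zero =>
    intro x y p hp
    have : p = 0 := by
      have := D_eq LinearMap.id 0 (fun M hM => absurd hM (by omega)) hp
      simpa using this
    simp [C, this]
  | succ n ih =>
    have key : ∀ (M : I →₀ ℕ), M.degree < n + 1 → ∀ x y, C b x y (mon K M) := by
      intro M hM x y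
      refine C_bilin b (fun i j => ?_) x y
      by_cases hj : Le j M
      · exact C_le b hj
      by_cases hi : Le i M
      · exact C_symm b (C_le b hi)
      have hM0 : M ≠ 0 := by
        rintro rfl
        exact hj (fun k hk => absurd rfl hk)
      obtain ⟨k, N, rfl, hk⟩ := Le_exists hM0
      rw [deg_single] at hM
      have lt_of : ∀ i, ¬ Le i (Finsupp.single k 1 + N) → k < i := by
        intro i hi
        by_contra hc
        refine hi (fun l hl => (not_lt.1 hc).trans ?_)
        by_cases e : k = l
        · exact e.le
        · exact hk l (by simpa [Finsupp.single_apply, e] using hl)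
      have hN : mon K N ∈ D K I n := mon_mem (by omega)
      -- commuting `k` past `x` on `y z_N`
      have aux : ∀ i j, k < j → C b (b i) (b k) (Phi b (b j) (mon K N)) := by
        intro i j hj
        have : Phi b (b j) (mon K N) = mon K (Finsupp.single j 1 + N) +
          (Phi b (b j) (mon K N) - X j * mon K N) := by rw [X_mon]; abel
        rw [this]
        refine C_add b (C_le b ?_) (ih _ _ _ (Phi_sub b _ _ _ hN))
        intro l hl
        by_cases e : j = l
        · exact e ▸ hj.le
        · exact hk l (by simpa [Finsupp.single_apply, e] using hl)
      have h1 := aux i j (lt_of j hj)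
      have h2 := aux j i (lt_of i hi)
      have h3 := ih (b j) (b k) _ hN
      have h4 := ih (b i) (b k) _ hN
      have h5 := ih (b i) ⁅b j, b k⁆ _ hN
      have h6 := ih (b j) ⁅b i, b k⁆ _ hN
      have h7 := ih (b i) (b j) _ hN
      have h8 := ih ⁅b i, b j⁆ (b k) _ hN
      have jac : Phi b ⁅⁅b i, b j⁆, b k⁆ (mon K N) =
        Phi b ⁅b i, ⁅b j, b k⁆⁆ (mon K N) - Phi b ⁅b j, ⁅b i, b k⁆⁆ (mon K N) := by
        rw [lie_lie, map_sub, LinearMap.sub_apply]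
      rw [C, ← Phi_le b hk]
      unfold C at *
      rw [sub_eq_iff_eq_add] at h1 h2 h3 h4 h5 h6 h7 h8
      have h7' := congrArg (Phi b (b k)) h7
      rw [map_add] at h7'
      rw [h3, h4, h8, jac]
      simp only [map_add]
      rw [h1, h2, h5, h6, h7']
      abel
    intro x y p hp
    exact D_eq (Phi b x ∘ₗ Phi b y - Phi b y ∘ₗ Phi b x) (Phi b ⁅x, y⁆)
      (fun M hM => key M hM x y) hp


attribute [local instance] LieRing.ofAssociativeRing

section U
omit [LinearOrder I]

abbrev U (K L : Type) [CommRing K] [LieRing L] [LieAlgebra K L] := UniversalEnvelopingAlgebra K L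

noncomputable def io (x : L) : U K L := UniversalEnvelopingAlgebra.ι K x

lemma io_lie (x y : L) : (io ⁅x, y⁆ : U K L) = io x * io y - io y * io x := by
  unfold io
  rw [LieHom.map_lie, LieRing.of_associative_ring_bracket]

/-- product of basis elements -/
noncomputable def pr (b : Module.Basis I K L) (l : List I) : U K L :=
  (l.map (fun i => (io (b i) : U K L))).prod

lemma pr_cons (b : Module.Basis I K L) (i l) : pr b (i :: l) = io (b i) * pr b l := by simp [pr]

/-- filtration of `U`: products of `< n` factors -/
noncomputable def Uf (b : Module.Basis I K L) (n : ℕ) : Submodule K (U K L) :=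
  Submodule.span K {u | ∃ l : List I, l.length < n ∧ u = pr b l}

lemma Uf_mono (b : Module.Basis I K L) {m n : ℕ} (h : m ≤ n) : Uf b m ≤ Uf b n :=
  Submodule.span_mono (fun _ ⟨M, hM, e⟩ => ⟨M, by omega, e⟩)

lemma pr_mem (b : Module.Basis I K L) {l : List I} {n : ℕ} (h : l.length < n) : pr b l ∈ Uf b n :=
  Submodule.subset_span ⟨l, h, rfl⟩

lemma Uf_mul (b : Module.Basis I K L) {m n : ℕ} {u v : U K L} (hu : u ∈ Uf b (m + 1))
    (hv : v ∈ Uf b n) : u * v ∈ Uf b (m + n) := by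
  induction hu using Submodule.span_induction with
  | mem x h =>
    obtain ⟨l, hl, rfl⟩ := h
    induction hv using Submodule.span_induction with
    | mem x h =>
      obtain ⟨l', hl', rfl⟩ := h
      have : pr b l * pr b l' = pr b (l ++ l') := by simp [pr]
      rw [this]
      exact pr_mem b (by simp; omega)
    | zero => simp
    | add x y _ _ hx hy => rw [mul_add]; exact add_mem hx hy
    | smul a x _ hx => rw [mul_smul_comm]; exact Submodule.smul_mem _ _ hx
  | zero => simp
  | add x y _ _ hx hy => rw [add_mul]; exact add_mem hx hy
  | smul a x _ hx => rw [smul_mul_assoc]; exact Submodule.smul_mem _ _ hx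

lemma io_mem (b : Module.Basis I K L) (x : L) : (io x : U K L) ∈ Uf b 2 := by
  induction x using basis_ind b with
  | zero => simp [io]
  | coe i => 
    have : (io (b i) : U K L) = pr b [i] := by simp [pr]
    rw [this]; exact pr_mem b (by simp)
  | add x y hx hy => simpa only [io, map_add] using add_mem hx hy
  | smul a x hx => simpa only [io, map_smul] using Submodule.smul_mem _ a hx

lemma io_mul_mem (b : Module.Basis I K L) (x : L) {n : ℕ} {v : U K L} (hv : v ∈ Uf b n) :
    io x * v ∈ Uf b (n + 1) := by
  rw [add_comm]; exact Uf_mul b (io_mem b x) hv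

lemma one_eq (b : Module.Basis I K L) : (1 : U K L) = pr b [] := by simp [pr]

lemma mem_Uf (b : Module.Basis I K L) (u : U K L) : ∃ n, u ∈ Uf b n := by
  have hs : Function.Surjective (UniversalEnvelopingAlgebra.mkAlgHom K L) :=
    RingCon.mk'_surjective _
  obtain ⟨a, rfl⟩ := hs u
  induction a using TensorAlgebra.induction with
  | algebraMap r =>
    refine ⟨1, ?_⟩
    rw [AlgHom.commutes, Algebra.algebraMap_eq_smul_one, one_eq b]
    exact Submodule.smul_mem _ _ (pr_mem b (by simp))
  | ι x =>
    exact ⟨2, io_mem b x⟩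
  | mul x y hx hy =>
    obtain ⟨n, hn⟩ := hx
    obtain ⟨m, hm⟩ := hy
    rw [map_mul]
    exact ⟨n + m, Uf_mul b (Uf_mono b (by omega) hn) hm⟩
  | add x y hx hy =>
    obtain ⟨n, hn⟩ := hx
    obtain ⟨m, hm⟩ := hy
    rw [map_add]
    exact ⟨max n m, add_mem (Uf_mono b (le_max_left _ _) hn) (Uf_mono b (le_max_right _ _) hm)⟩

lemma pr_perm (b : Module.Basis I K L) {l l' : List I} (h : l.Perm l') :
    pr b l - pr b l' ∈ Uf b l.length := by
  induction h with
  | nil => simp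
  | cons x _ ih =>
    rw [pr_cons, pr_cons, ← mul_sub]
    exact io_mul_mem b _ ih
  | swap x y l =>
    simp only [pr_cons]
    rw [← mul_assoc, ← mul_assoc, ← sub_mul, ← io_lie]
    exact io_mul_mem b _ (pr_mem b (by simp))
  | trans h1 h2 ih1 ih2 =>
    rw [← h1.length_eq] at ih2
    simpa using add_mem ih1 ih2

/-- a linear section of the symbol map -/
noncomputable def sg (b : Module.Basis I K L) : MvPolynomial I K →ₗ[K] U K L :=
  (basisMonomials I K).constr K (fun M => pr b (Finsupp.toMultiset M).toList)

lemma sg_mon (b : Module.Basis I K L) (M : I →₀ ℕ) :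
    sg b (mon K M) = pr b (Finsupp.toMultiset M).toList := by
  have : mon K M = basisMonomials I K M := by simp [mon]
  rw [sg, this, Module.Basis.constr_basis]

lemma toM_card (M : I →₀ ℕ) : (Finsupp.toMultiset M).toList.length = M.degree := by
  rw [Multiset.length_toList, Finsupp.card_toMultiset]
  rfl

/-- span of monomials of degree exactly `n` -/
noncomputable def H (K I : Type) [CommRing K] (n : ℕ) : Submodule K (MvPolynomial I K) :=
  Submodule.span K {p | ∃ M : I →₀ ℕ, M.degree = n ∧ p = mon K M}

lemma H_X {n : ℕ} {s} (i : I) (hs : s ∈ H K I n) : X i * s ∈ H K I (n + 1) := by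
  induction hs using Submodule.span_induction with
  | mem x h =>
    obtain ⟨M, hM, rfl⟩ := h
    rw [X_mon]
    exact Submodule.subset_span ⟨_, by rw [deg_single, hM], rfl⟩
  | zero => simp
  | add x y _ _ hx hy => rw [mul_add]; exact add_mem hx hy
  | smul a x _ hx => rw [mul_smul_comm]; exact Submodule.smul_mem _ _ hx

lemma sg_X (b : Module.Basis I K L) {n : ℕ} {s} (i : I) (hs : s ∈ H K I n) :
    io (b i) * sg b s - sg b (X i * s) ∈ Uf b (n + 1) := by
  induction hs using Submodule.span_induction with
  | mem x h =>
    obtain ⟨M, hM, rfl⟩ := h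
    rw [X_mon, sg_mon, sg_mon, ← pr_cons]
    have hp : (i :: (Finsupp.toMultiset M).toList).Perm
        (Finsupp.toMultiset (Finsupp.single i 1 + M)).toList := by
      rw [← Multiset.coe_eq_coe, ← Multiset.cons_coe]
      simp [Finsupp.toMultiset_single]
    have := pr_perm b hp
    rwa [List.length_cons, toM_card, hM] at this
  | zero => simp
  | add x y _ _ hx hy =>
    have := add_mem hx hy
    rw [map_add, mul_add, mul_add, map_add]
    convert this using 1
    abel
  | smul a x _ hx =>
    have := Submodule.smul_mem _ a hx
    rw [map_smul, mul_smul_comm, mul_smul_comm, map_smul, ← smul_sub]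
    exact this

lemma H_le_D (n : ℕ) : H K I n ≤ D K I (n + 1) :=
  Submodule.span_mono (fun _ ⟨M, hM, e⟩ => ⟨M, by omega, e⟩)

lemma H_hom {n : ℕ} {s} (hs : s ∈ H K I n) : s.IsHomogeneous n := by
  have : H K I n ≤ homogeneousSubmodule I K n := by
    refine Submodule.span_le.2 ?_
    rintro _ ⟨M, hM, rfl⟩
    exact isHomogeneous_monomial _ hM
  exact this hs

lemma D_comp {n : ℕ} {p} (hp : p ∈ D K I n) : homogeneousComponent n p = 0 := by
  have : D K I n ≤ LinearMap.ker (homogeneousComponent (R := K) (σ := I) n) := by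
    refine Submodule.span_le.2 ?_
    rintro _ ⟨M, hM, rfl⟩
    have h : (mon K M).IsHomogeneous M.degree := isHomogeneous_monomial _ rfl
    rw [SetLike.mem_coe, LinearMap.mem_ker, homogeneousComponent_of_mem h, if_neg (by omega)]
  exact this hp

lemma H_mul_D {n m : ℕ} {s p} (hs : s ∈ H K I n) (hp : p ∈ D K I m) : s * p ∈ D K I (n + m) := by
  induction hs using Submodule.span_induction with
  | mem x h =>
    obtain ⟨M, hM, rfl⟩ := h
    induction hp using Submodule.span_induction with
    | mem x h =>
      obtain ⟨N, hN, rfl⟩ := h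
      have : mon K M * mon K N = mon K (M + N) := by simp [mon, monomial_mul]
      rw [this]
      exact mon_mem (by rw [map_add]; omega)
    | zero => simp
    | add x y _ _ hx hy => rw [mul_add]; exact add_mem hx hy
    | smul a x _ hx => rw [mul_smul_comm]; exact Submodule.smul_mem _ _ hx
  | zero => simp
  | add x y _ _ hx hy => rw [add_mul]; exact add_mem hx hy
  | smul a x _ hx => rw [smul_mul_assoc]; exact Submodule.smul_mem _ _ hx

end U

/-- The representation of `U`. -/
noncomputable def rho (b : Module.Basis I K L) : U K L →ₐ[K] Module.End K (MvPolynomial I K) :=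
  UniversalEnvelopingAlgebra.lift K
    { Phi b with
      map_lie' := by
        intro x y
        refine LinearMap.ext fun p => ?_
        obtain ⟨n, hn⟩ := mem_D p
        have := C_all b n x y p hn
        rw [C] at this
        rw [LieRing.of_associative_ring_bracket]
        exact this.symm }

lemma rho_io (b : Module.Basis I K L) (x : L) : rho b (io x) = Phi b x := by
  unfold rho io
  rw [UniversalEnvelopingAlgebra.lift_ι_apply]
  rfl

/-- `s` is the degree `n` symbol of `u` -/
structure R (b : Module.Basis I K L) (n : ℕ) (u : U K L) (s : MvPolynomial I K) : Prop where
  hom : s ∈ H K I n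
  sec : u - sg b s ∈ Uf b n
  act : ∀ m p, p ∈ D K I (m + 1) → rho b u p - s * p ∈ D K I (n + m)

lemma R_cons (b : Module.Basis I K L) {n u s} (i : I) (h : R b n u s) :
    R b (n + 1) (io (b i) * u) (X i * s) where
  hom := H_X i h.hom
  sec := by
    have := add_mem (io_mul_mem b (b i) h.sec) (sg_X b i h.hom)
    rw [mul_sub] at this
    simpa using this
  act := by
    intro m p hp
    have h1 := h.act m p hp
    have hsp := H_mul_D h.hom hp
    have h2 : rho b u p ∈ D K I (n + m + 1) := by
      have := add_mem (D_mono (Nat.le_succ _) h1) hsp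
      simpa using this
    have h3 := add_mem (Phi_sub b i _ _ h2) (X_mem (i := i) h1)
    rw [map_mul, Module.End.mul_apply, rho_io]
    rw [mul_sub, sub_add_sub_cancel, ← mul_assoc] at h3
    exact D_mono (by omega) h3

lemma R_one (b : Module.Basis I K L) : R b 0 1 1 where
  hom := Submodule.subset_span ⟨0, by simp, by simp [mon]⟩
  sec := by
    have : (1 : MvPolynomial I K) = mon K 0 := by simp [mon]
    rw [this, sg_mon]
    simp [pr]
  act := by
    intro m p hp
    simp

lemma R_list (b : Module.Basis I K L) (l : List I) : ∃ s, R b l.length (pr b l) s := by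
  induction l with
  | nil => exact ⟨1, by rw [← one_eq]; exact R_one b⟩
  | cons i l ih =>
    obtain ⟨s, hs⟩ := ih
    exact ⟨_, by rw [pr_cons]; exact R_cons b i hs⟩

lemma R_exists (b : Module.Basis I K L) {n : ℕ} {u : U K L} (hu : u ∈ Uf b (n + 1)) :
    ∃ s, R b n u s := by
  induction hu using Submodule.span_induction with
  | mem x h =>
    obtain ⟨l, hl, rfl⟩ := h
    obtain ⟨s, hs⟩ := R_list b l
    by_cases e : l.length = n
    · exact ⟨s, e ▸ hs⟩
    · refine ⟨0, zero_mem _, ?_, ?_⟩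
      · rw [map_zero, sub_zero]
        exact pr_mem b (by omega)
      · intro m p hp
        have h1 : s * p ∈ D K I (l.length + (m + 1)) := H_mul_D hs.hom hp
        have h2 := D_mono (by omega : l.length + m ≤ l.length + (m + 1)) (hs.act m p hp)
        have := add_mem h2 h1
        rw [sub_add_cancel] at this
        rw [zero_mul, sub_zero]
        exact D_mono (by omega : l.length + (m + 1) ≤ n + m) this
  | zero => exact ⟨0, zero_mem _, by simp, by simp⟩
  | add x y _ _ hx hy =>
    obtain ⟨s, hs⟩ := hx
    obtain ⟨t, ht⟩ := hy
    refine ⟨s + t, add_mem hs.hom ht.hom, ?_, ?_⟩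
    · rw [map_add, add_sub_add_comm]; exact add_mem hs.sec ht.sec
    · intro m p hp
      rw [map_add, add_mul, LinearMap.add_apply, add_sub_add_comm]
      exact add_mem (hs.act m p hp) (ht.act m p hp)
  | smul a x _ hx =>
    obtain ⟨s, hs⟩ := hx
    refine ⟨a • s, Submodule.smul_mem _ _ hs.hom, ?_, ?_⟩
    · rw [map_smul, ← smul_sub]; exact Submodule.smul_mem _ _ hs.sec
    · intro m p hp
      rw [map_smul, smul_mul_assoc, LinearMap.smul_apply, ← smul_sub]
      exact Submodule.smul_mem _ _ (hs.act m p hp)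

lemma R_nonzero (b : Module.Basis I K L) {u : U K L} (hu : u ≠ 0) :
    ∃ n s, u ∈ Uf b (n + 1) ∧ R b n u s ∧ s ≠ 0 := by
  classical
  have hex := mem_Uf b u
  have hspec := Nat.find_spec hex
  have hmin := fun m => Nat.find_min hex (m := m)
  generalize Nat.find hex = k at hspec hmin
  cases k with
  | zero =>
    refine absurd ?_ hu
    have : Uf b 0 = ⊥ := by
      rw [Uf, Submodule.span_eq_bot]
      rintro _ ⟨l, hl, _⟩
      omega
    rwa [this, Submodule.mem_bot] at hspec
  | succ n =>
    obtain ⟨s, hs⟩ := R_exists b hspec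
    refine ⟨n, s, hspec, hs, ?_⟩
    rintro rfl
    have := hs.sec
    rw [map_zero, sub_zero] at this
    exact hmin n (by omega) this

omit [LinearOrder I] in
lemma Uf_one (b : Module.Basis I K L) {u : U K L} (hu : u ∈ Uf b 1) :
    ∃ c : K, u = algebraMap K (U K L) c := by
  have : Uf b 1 = Submodule.span K {(1 : U K L)} := by
    rw [Uf]
    congr 1
    ext v
    constructor
    · rintro ⟨l, hl, rfl⟩
      have : l = [] := List.eq_nil_of_length_eq_zero (by omega)
      subst this
      simp [pr]
    · rintro rfl
      exact ⟨[], by simp, one_eq b⟩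
  rw [this, Submodule.mem_span_singleton] at hu
  obtain ⟨c, rfl⟩ := hu
  exact ⟨c, (Algebra.algebraMap_eq_smul_one c).symm⟩

lemma main [IsDomain K] (b : Module.Basis I K L) (u : U K L) (hu : IsUnit u) :
    ∃ c : K, u = algebraMap K (U K L) c := by
  obtain ⟨v, huv⟩ := hu.exists_right_inv
  by_cases h0 : u = 0
  · exact ⟨0, by simp [h0]⟩
  have hv0 : v ≠ 0 := by
    rintro rfl
    rw [mul_zero] at huv
    exact h0 (by rw [← mul_one u, ← huv, mul_zero])
  obtain ⟨n, s, hn, hs, hs0⟩ := R_nonzero b h0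
  obtain ⟨m, t, hm, ht, ht0⟩ := R_nonzero b hv0
  have one_mem : (1 : MvPolynomial I K) ∈ D K I (0 + 1) := by
    have : (1 : MvPolynomial I K) = mon K 0 := by simp [mon]
    rw [this]; exact mon_mem (by simp)
  have h1 := ht.act 0 1 one_mem
  rw [mul_one, add_zero] at h1
  have h2 : rho b v 1 ∈ D K I (m + 1) := by
    simpa using add_mem (D_mono (Nat.le_succ _) h1) (H_le_D m ht.hom)
  have h3 := add_mem (hs.act m _ h2) (H_mul_D hs.hom h1)
  rw [← Module.End.mul_apply, ← map_mul, huv, map_one (rho b), Module.End.one_apply, mul_sub,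
    sub_add_sub_cancel] at h3
  have h4 := D_comp h3
  have hst : (s * t).IsHomogeneous (n + m) := (H_hom hs.hom).mul (H_hom ht.hom)
  rw [map_sub, homogeneousComponent_of_mem hst, if_pos rfl,
    homogeneousComponent_of_mem (isHomogeneous_one I K)] at h4
  by_cases e : n + m = 0
  · have : n = 0 := by omega
    subst this
    exact Uf_one b hn
  · rw [if_neg e, zero_sub, neg_eq_zero] at h4
    exact absurd h4 (mul_ne_zero hs0 ht0)

end PBW

/-- if `K` is an integral domain and `L` a Lie algebra over `K` that is
free as a `K`-module, then every unit of the universal enveloping algebra `U(L)` lies in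
the image of `K`. -/
theorem stmt15 (K L : Type) [CommRing K] [IsDomain K] [LieRing L] [LieAlgebra K L]
    [Module.Free K L] (u : UniversalEnvelopingAlgebra K L) (hu : IsUnit u) :
    ∃ c : K, u = algebraMap K (UniversalEnvelopingAlgebra K L) c := by
  classical
  let _ : LinearOrder (Module.Free.ChooseBasisIndex K L) :=
    linearOrderOfSTO WellOrderingRel
  exact PBW.main (Module.Free.chooseBasis K L) u hu
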